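/- arXiv:2402.08836 — 2 statements merged into one kernel-verified Lean document; each statement's English description precedes it below -/
import Mathlib

section
/- Let v : ℝⁿ → ℝⁿ be continuous on a closed ball B̄(x₀, r₀), with v(x₀) = 0, and suppose v is differentiable at x₀ with invertible Fréchet derivative A = Dv(x₀). Then there exist r ∈ (0, r₀] and ε > 0 such that every continuous map w : ℝⁿ → ℝⁿ satisfying sup_{‖x − x₀‖ ≤ r} ‖w(x) − v(x)‖ ≤ ε has at least one zero in the closed ball B̄(x₀, r). (A nondegenerate zero of a vector field persists under C⁰-small perturbations.) -/
open Metric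

/-- A map which is Lipschitz on the closed unit ball and vanishes on the unit sphere stays
Lipschitz when it is extended by zero. -/
theorem LipschitzOnWith.indicator_closedBall {E F : Type*} [NormedAddCommGroup E]
    [NormedSpace ℝ E] [NormedAddCommGroup F] {K : NNReal} {g : E → F}
    (hg : LipschitzOnWith K g (closedBall 0 1)) (hg0 : ∀ x, ‖x‖ = 1 → g x = 0) :
    LipschitzWith K ((closedBall (0 : E) 1).indicator g) := by
  have key : ∀ x ∈ closedBall (0 : E) 1, ∀ y ∉ closedBall (0 : E) 1,
      dist (g x) 0 ≤ K * dist x y := by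
    intro x hx y hy
    rw [mem_closedBall_zero_iff] at hx hy
    obtain ⟨z, hz, hz1⟩ : (1 : ℝ) ∈ norm '' segment ℝ x y :=
      (convex_segment x y).isPreconnected.intermediate_value (left_mem_segment ℝ x y)
        (right_mem_segment ℝ x y) continuous_norm.continuousOn ⟨hx, (not_le.1 hy).le⟩
    have h := hg.dist_le_mul x (mem_closedBall_zero_iff.2 hx) z (mem_closedBall_zero_iff.2 hz1.le)
    rw [hg0 z hz1] at h
    refine h.trans (mul_le_mul_of_nonneg_left ?_ K.2)
    linarith [dist_add_dist_of_mem_segment hz, dist_nonneg (x := z) (y := y)]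
  refine LipschitzWith.of_dist_le_mul fun x y => ?_
  by_cases hx : x ∈ closedBall (0 : E) 1 <;> by_cases hy : y ∈ closedBall (0 : E) 1
  · simpa only [Set.indicator_of_mem hx, Set.indicator_of_mem hy] using hg.dist_le_mul x hx y hy
  · simpa only [Set.indicator_of_mem hx, Set.indicator_of_notMem hy] using key x hx y hy
  · rw [Set.indicator_of_notMem hx, Set.indicator_of_mem hy, dist_comm, dist_comm x]
    exact key y hy x hx
  · rw [Set.indicator_of_notMem hx, Set.indicator_of_notMem hy, dist_self]
    positivity

/-- Small multiples of a Lipschitz map vanishing on the unit sphere perturb the identity to a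
bijection of the closed unit ball. -/
theorem LipschitzOnWith.bijOn_add_smul_closedBall {E : Type*} [NormedAddCommGroup E]
    [NormedSpace ℝ E] [CompleteSpace E] {K : NNReal} {g : E → E}
    (hg : LipschitzOnWith K g (closedBall 0 1)) (hg0 : ∀ x, ‖x‖ = 1 → g x = 0)
    {t : NNReal} (ht : t * K < 1) :
    Set.BijOn (fun x => x + (t : ℝ) • g x) (closedBall 0 1) (closedBall 0 1) := by
  set G := (closedBall (0 : E) 1).indicator g
  have hGl : LipschitzWith K G := hg.indicator_closedBall hg0
  have hGB : ∀ x ∈ closedBall (0 : E) 1, G x = g x := fun x hx => Set.indicator_of_mem hx g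
  have hGn : ∀ x ∉ closedBall (0 : E) 1, G x = 0 := fun x hx => Set.indicator_of_notMem hx g
  have hcon : ∀ y : E, ContractingWith (t * K) fun x => y - (t : ℝ) • G x := by
    refine fun y => ⟨ht, LipschitzWith.of_dist_le_mul fun a b => ?_⟩
    rw [dist_sub_left, dist_smul₀]
    have := mul_le_mul_of_nonneg_left (hGl.dist_le_mul a b) t.2
    simpa [mul_assoc] using this
  have huniq : ∀ y a b : E, a + (t : ℝ) • G a = y → b + (t : ℝ) • G b = y → a = b := by
    intro y a b ha hb
    exact (hcon y).fixedPoint_unique' (sub_eq_of_eq_add ha.symm) (sub_eq_of_eq_add hb.symm)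
  have hex : ∀ y : E, ∃ a, a + (t : ℝ) • G a = y := by
    intro y
    refine ⟨(hcon y).fixedPoint, ?_⟩
    have h : y - (t : ℝ) • G (hcon y).fixedPoint = (hcon y).fixedPoint :=
      (hcon y).fixedPoint_isFixedPt
    exact (sub_eq_iff_eq_add.1 h).symm
  refine ⟨fun x hx => ?_, fun a ha b hb hab => ?_, fun y hy => ?_⟩
  · by_contra hn
    refine hn ?_
    have h : x = x + (t : ℝ) • g x :=
      huniq (x + (t : ℝ) • g x) _ _ (by rw [hGB x hx]) (by rw [hGn _ hn, smul_zero, add_zero])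
    exact (congrArg (· ∈ closedBall (0 : E) 1) h).mp hx
  · refine huniq _ a b rfl ?_
    rw [hGB a ha, hGB b hb]
    exact hab.symm
  · obtain ⟨a, ha⟩ := hex y
    by_cases haB : a ∈ closedBall (0 : E) 1
    · exact ⟨a, haB, by rw [← ha, hGB a haB]⟩
    · rw [hGn a haB, smul_zero, add_zero] at ha
      exact absurd (ha ▸ hy) haB

/-- `det (1 + t L)` is a polynomial in `t` of degree at most the dimension. -/
theorem LinearMap.exists_polynomial_det_one_add_smul {E : Type*} [AddCommGroup E] [Module ℝ E]
    [FiniteDimensional ℝ E] (L : E →ₗ[ℝ] E) :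
    ∃ p : Polynomial ℝ, p.natDegree ≤ Module.finrank ℝ E ∧
      ∀ t : ℝ, p.eval t = LinearMap.det (1 + t • L) := by
  classical
  set b := Module.finBasis ℝ E
  refine ⟨_, (Polynomial.natDegree_det_X_add_C_le (LinearMap.toMatrix b b L) 1).trans_eq
    (Fintype.card_fin _), fun t => ?_⟩
  rw [← LinearMap.det_toMatrix b, ← Polynomial.coe_evalRingHom, RingHom.map_det]
  congr 1
  ext i j
  by_cases hij : i = j <;> simp [LinearMap.toMatrix_one, hij] <;> ring

open MeasureTheory in
/-- The integral of `det (1 + t G(x))` over a set is determined by its values at small `t > 0`: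
if it is constant there, the constant is also the value at `t = 1`. -/
theorem integral_det_one_add_eq_of_small {E : Type*} [NormedAddCommGroup E]
    [NormedSpace ℝ E] [FiniteDimensional ℝ E] [MeasurableSpace E] [BorelSpace E]
    (μ : Measure E) [IsFiniteMeasureOnCompacts μ] {s : Set E} (hs : IsCompact s)
    {G : E → E →L[ℝ] E} (hG : Continuous G) {η c : ℝ} (hη : 0 < η)
    (h : ∀ t : ℝ, 0 < t → t < η → ∫ x in s, (1 + t • G x).det ∂μ = c) :
    ∫ x in s, (1 + G x).det ∂μ = c := by
  set d := Module.finrank ℝ E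
  set S := Finset.range (d + 1)
  let a : ℕ → ℝ := fun i => η / (i + 2)
  have ha : Set.InjOn a S := by
    intro i _ j _ hij
    have h2 : (i : ℝ) + 2 = j + 2 := by
      have := congrArg (fun z => η / z) hij
      simpa only [a, div_div_cancel₀ hη.ne'] using this
    exact_mod_cast add_right_cancel h2
  have hdet : ∀ x, (1 + G x).det
      = ∑ i ∈ S, (Lagrange.basis S a i).eval 1 * (1 + a i • G x).det := by
    intro x
    obtain ⟨p, hp, hpe⟩ := LinearMap.exists_polynomial_det_one_add_smul (G x : E →ₗ[ℝ] E)
    have hdeg : p.degree < S.card := by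
      rw [Finset.card_range]
      exact (Polynomial.degree_le_of_natDegree_le hp).trans_lt (by exact_mod_cast Nat.lt_succ_self d)
    have he : ∀ t : ℝ, (1 + t • G x).det = p.eval t := fun t => (hpe t).symm
    have h1 := he 1
    rw [one_smul] at h1
    rw [h1, Lagrange.eq_interpolate ha hdeg, Lagrange.interpolate_apply, Polynomial.eval_finsetSum]
    refine Finset.sum_congr rfl fun i _ => ?_
    rw [Polynomial.eval_mul, Polynomial.eval_C, he, mul_comm]
  have hint : ∀ t : ℝ, IntegrableOn (fun x => (1 + t • G x).det) s μ := fun t =>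
    (ContinuousLinearMap.continuous_det.comp
      (continuous_const.add (hG.const_smul t))).continuousOn.integrableOn_compact hs
  simp_rw [hdet]
  rw [integral_finsetSum _ fun i _ => (hint (a i)).const_mul _]
  have hval : ∀ i ∈ S, ∫ x in s, (Lagrange.basis S a i).eval 1 * (1 + a i • G x).det ∂μ
      = (Lagrange.basis S a i).eval 1 * c := by
    intro i _
    rw [integral_const_mul, h (a i) (by positivity)]
    exact div_lt_self hη (by linarith [(Nat.cast_nonneg i : (0 : ℝ) ≤ i)])
  rw [Finset.sum_congr rfl hval, ← Finset.sum_mul, ← Polynomial.eval_finsetSum,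
    Lagrange.sum_basis ha ⟨0, by simp [S]⟩, Polynomial.eval_one, one_mul]

open MeasureTheory in
/-- **No-retraction theorem**, `C¹` version. -/
theorem not_contDiff_retraction_sphere {E : Type*} [NormedAddCommGroup E] [InnerProductSpace ℝ E]
    [FiniteDimensional ℝ E] {R : E → E} (hR : ContDiff ℝ 1 R) (hR1 : ∀ x, ‖R x‖ = 1)
    (hRS : ∀ x, ‖x‖ = 1 → R x = x) : False := by
  borelize E
  let μ : Measure E := Measure.addHaar
  let g : E → E := fun x => R x - x
  have hgC : ContDiff ℝ 1 g := hR.sub contDiff_id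
  have hgd : Differentiable ℝ g := hgC.differentiable one_ne_zero
  have hG : Continuous (fderiv ℝ g) := hgC.continuous_fderiv one_ne_zero
  have hg0 : ∀ x, ‖x‖ = 1 → g x = 0 := fun x hx => sub_eq_zero.2 (hRS x hx)
  have hB : IsCompact (closedBall (0 : E) 1) := isCompact_closedBall 0 1
  obtain ⟨C, hC⟩ := hB.exists_bound_of_continuousOn hG.continuousOn
  set K : NNReal := C.toNNReal
  have hK : ∀ x ∈ closedBall (0 : E) 1, ‖fderiv ℝ g x‖ ≤ K :=
    fun x hx => (hC x hx).trans (Real.le_coe_toNNReal C)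
  have hgl : LipschitzOnWith K g (closedBall 0 1) :=
    (convex_closedBall (0 : E) 1).lipschitzOnWith_of_nnnorm_fderiv_le (fun x _ => hgd x) hK
  obtain ⟨δ, hδ, hdet⟩ : ∃ δ > 0, ∀ L : E →L[ℝ] E, dist L 1 < δ → 0 < L.det := by
    refine Metric.eventually_nhds_iff.1 (ContinuousLinearMap.continuous_det.continuousAt.eventually
      (lt_mem_nhds ?_))
    have : (1 : E →L[ℝ] E).det = 1 := LinearMap.det_id
    exact one_pos.trans_eq this.symm
  have hsmall : ∀ t : ℝ, 0 < t → t < min 1 δ / (K + 1) →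
      ∫ x in closedBall (0 : E) 1, (1 + t • fderiv ℝ g x).det ∂μ = μ.real (closedBall 0 1) := by
    intro t ht htη
    rw [lt_div_iff₀ (by positivity)] at htη
    have htK : t * K < min 1 δ := by nlinarith
    lift t to NNReal using ht.le
    have hbij := hgl.bijOn_add_smul_closedBall hg0 (t := t)
      (NNReal.coe_lt_coe.1 (by simpa using htK.trans_le (min_le_left _ _)))
    have hderiv : ∀ x ∈ closedBall (0 : E) 1, HasFDerivWithinAt (fun x => x + (t : ℝ) • g x)
        (1 + (t : ℝ) • fderiv ℝ g x) (closedBall 0 1) x := fun x _ =>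
      ((hasFDerivAt_id x).add ((hgd x).hasFDerivAt.const_smul (t : ℝ))).hasFDerivWithinAt
    have hcv := integral_image_eq_integral_abs_det_fderiv_smul μ measurableSet_closedBall hderiv
      hbij.injOn (fun _ => (1 : ℝ))
    rw [hbij.image_eq, setIntegral_const, smul_eq_mul, mul_one] at hcv
    rw [hcv]
    refine setIntegral_congr_fun measurableSet_closedBall fun x hx => ?_
    have hpos : 0 < (1 + (t : ℝ) • fderiv ℝ g x).det := by
      refine hdet _ ?_
      rw [dist_eq_norm, add_sub_cancel_left, norm_smul, Real.norm_of_nonneg t.coe_nonneg]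
      exact (mul_le_mul_of_nonneg_left (hK x hx) t.2).trans_lt (htK.trans_le (min_le_right _ _))
    simp only [smul_eq_mul, mul_one, abs_of_pos hpos]
  have hone := integral_det_one_add_eq_of_small μ hB hG (by positivity) hsmall
  have hsing : ∀ x, (1 + fderiv ℝ g x).det = 0 := by
    intro x
    have hfd : 1 + fderiv ℝ g x = fderiv ℝ R x := by
      have h1 : HasFDerivAt g (fderiv ℝ R x - 1) x :=
        ((hR.differentiable one_ne_zero) x).hasFDerivAt.sub (hasFDerivAt_id x)
      rw [h1.fderiv, add_sub_cancel]
    rw [hfd]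
    by_contra hne
    have hRd := ((hR.differentiable one_ne_zero) x).hasFDerivAt
    have hn : HasFDerivAt (fun y => ‖R y‖ ^ 2) (2 • (innerSL ℝ (R x)).comp (fderiv ℝ R x)) x :=
      hRd.norm_sq
    have hc : (fun y => ‖R y‖ ^ 2) = fun _ => (1 : ℝ) := by
      funext y
      rw [hR1, one_pow]
    rw [hc] at hn
    have h0 := hn.unique (hasFDerivAt_const (1 : ℝ) x)
    obtain ⟨z, hz⟩ : ∃ z, fderiv ℝ R x z = R x :=
      (LinearMap.equivOfDetNeZero (fderiv ℝ R x : E →ₗ[ℝ] E) hne).surjective (R x)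
    have h1 := DFunLike.congr_fun h0 z
    simp [hz, hR1] at h1
  simp only [hsing, integral_zero] at hone
  have hpos : 0 < μ.real (closedBall (0 : E) 1) :=
    ENNReal.toReal_pos (measure_closedBall_pos μ 0 one_pos).ne' hB.measure_lt_top.ne
  exact hpos.ne hone

/-- A continuous map uniformly close to the identity on the closed unit ball vanishes there. -/
theorem Continuous.exists_zero_of_norm_sub_le {E : Type*} [NormedAddCommGroup E]
    [InnerProductSpace ℝ E] [FiniteDimensional ℝ E] {u : E → E} (hu : Continuous u)
    (h : ∀ x ∈ closedBall (0 : E) 1, ‖u x - x‖ ≤ 1 / 2) :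
    ∃ x ∈ closedBall (0 : E) 1, u x = 0 := by
  by_contra! hne
  obtain ⟨m, hm, hmin⟩ := (isCompact_closedBall (0 : E) 1).exists_isMinOn
    (nonempty_closedBall.2 zero_le_one) hu.norm.continuousOn
  have hδ : 0 < ‖u m‖ := norm_pos_iff.2 (hne m hm)
  obtain ⟨p, hpC, hp, -⟩ := hu.exists_contDiff_approx 1
    (ε := fun _ => min ‖u m‖ (1 / 4)) continuous_const (fun _ => by positivity)
  let χ : ContDiffBump (0 : E) := ⟨4 / 5, 1, by norm_num, by norm_num⟩
  let f : E → E := fun x => x + χ x • (p x - x)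
  have hfC : ContDiff ℝ 1 f := contDiff_id.add (χ.contDiff.smul (hpC.sub contDiff_id))
  have hf1 : ∀ x, 1 ≤ ‖x‖ → f x = x := by
    intro x hx
    simp only [f]
    rw [χ.zero_of_le_dist (by simpa using hx), zero_smul, add_zero]
  have hf0 : ∀ x, f x ≠ 0 := by
    intro x hfx
    rcases le_or_gt 1 ‖x‖ with hx | hx
    · rw [hf1 x hx] at hfx
      rw [hfx, norm_zero] at hx
      linarith
    have hxB : x ∈ closedBall (0 : E) 1 := mem_closedBall_zero_iff.2 hx.le
    have hpx := lt_min_iff.1 (hp x)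
    rw [dist_eq_norm] at hpx
    rcases le_or_gt ‖x‖ (4 / 5) with hx' | hx'
    · have : χ x = 1 := χ.one_of_mem_closedBall (mem_closedBall_zero_iff.2 hx')
      simp only [f, this, one_smul, add_sub_cancel] at hfx
      rw [hfx, zero_sub, norm_neg] at hpx
      exact absurd (hmin hxB) (not_le.2 hpx.1)
    · have h1 : ‖x‖ = χ x * ‖p x - x‖ := by
        rw [← norm_neg, neg_eq_of_add_eq_zero_right hfx, norm_smul, Real.norm_of_nonneg χ.nonneg]
      have h2 : ‖p x - x‖ ≤ ‖p x - u x‖ + ‖u x - x‖ := norm_sub_le_norm_sub_add_norm_sub _ _ _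
      have h3 : χ x * ‖p x - x‖ ≤ ‖p x - x‖ := mul_le_of_le_one_left (norm_nonneg _) χ.le_one
      linarith [h x hxB, hpx.2]
  refine not_contDiff_retraction_sphere (R := fun x => ‖f x‖⁻¹ • f x)
    (((hfC.norm ℝ hf0).inv fun x => norm_ne_zero_iff.2 (hf0 x)).smul hfC) (fun x => ?_)
    fun x hx => ?_
  · exact norm_smul_inv_norm (𝕜 := ℝ) (hf0 x)
  · simp only [hf1 x hx.ge, hx, inv_one, one_smul]

/-- A nondegenerate zero of a continuous vector field on `ℝⁿ` persists under `C⁰`-small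
perturbations: if `v` is continuous on `B̄(x₀, r₀)`, `v(x₀) = 0`, and `v` is differentiable
at `x₀` with invertible derivative, then there are `r ∈ (0, r₀]` and `ε > 0` such that any
continuous `w` with `‖w − v‖ ≤ ε` on `B̄(x₀, r)` has a zero in `B̄(x₀, r)`. -/
theorem stmt14 {n : ℕ} (v : EuclideanSpace ℝ (Fin n) → EuclideanSpace ℝ (Fin n))
    (x₀ : EuclideanSpace ℝ (Fin n)) (r₀ : ℝ) (hr₀ : 0 < r₀)
    (hv : ContinuousOn v (closedBall x₀ r₀)) (hv0 : v x₀ = 0)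
    (A : EuclideanSpace ℝ (Fin n) ≃L[ℝ] EuclideanSpace ℝ (Fin n))
    (hA : HasFDerivAt v (A : EuclideanSpace ℝ (Fin n) →L[ℝ] EuclideanSpace ℝ (Fin n)) x₀) :
    ∃ r ∈ Set.Ioc (0 : ℝ) r₀, ∃ ε > (0 : ℝ),
      ∀ w : EuclideanSpace ℝ (Fin n) → EuclideanSpace ℝ (Fin n), Continuous w →
        (∀ x ∈ closedBall x₀ r, ‖w x - v x‖ ≤ ε) →
        ∃ x ∈ closedBall x₀ r, w x = 0 := by
  set c : ℝ :=
    1 / (4 * (‖(A.symm : EuclideanSpace ℝ (Fin n) →L[ℝ] EuclideanSpace ℝ (Fin n))‖ + 1)) with hc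
  have hc0 : 0 < c := by positivity
  have hAc : ‖(A.symm : EuclideanSpace ℝ (Fin n) →L[ℝ] EuclideanSpace ℝ (Fin n))‖ * (2 * c)
      ≤ 1 / 2 := by
    rw [hc]
    field_simp
    linarith
  obtain ⟨ρ, hρ, hlin⟩ := Metric.eventually_nhds_iff_ball.1 (hA.isLittleO.def hc0)
  set r := min r₀ (ρ / 2)
  have hr : 0 < r := by positivity
  refine ⟨r, ⟨hr, min_le_left _ _⟩, c * r, by positivity, fun w hw hwv => ?_⟩
  have hmem : ∀ y ∈ closedBall (0 : EuclideanSpace ℝ (Fin n)) 1,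
      x₀ + r • y ∈ closedBall x₀ r := by
    intro y hy
    rw [mem_closedBall_zero_iff] at hy
    rw [mem_closedBall, dist_self_add_left, norm_smul, Real.norm_of_nonneg hr.le]
    exact mul_le_of_le_one_right hr.le hy
  obtain ⟨y, hy, hy0⟩ := Continuous.exists_zero_of_norm_sub_le
    (u := fun y => r⁻¹ • A.symm (w (x₀ + r • y))) (by fun_prop) (by
      intro y hy
      have hyB := hmem y hy
      have hrρ : r < ρ := (min_le_right _ _).trans_lt (half_lt_self hρ)
      have h1 := hlin (x₀ + r • y) (closedBall_subset_ball hrρ hyB)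
      rw [mem_closedBall, dist_eq_norm, add_sub_cancel_left] at hyB
      rw [hv0, sub_zero, add_sub_cancel_left] at h1
      have h2 := hwv _ (hmem y hy)
      have h3 : ‖w (x₀ + r • y) - A (r • y)‖ ≤ 2 * c * r := by
        have := norm_sub_le_norm_sub_add_norm_sub (w (x₀ + r • y)) (v (x₀ + r • y)) (A (r • y))
        have h4 : c * ‖r • y‖ ≤ c * r := mul_le_mul_of_nonneg_left hyB hc0.le
        simp only [ContinuousLinearEquiv.coe_coe] at h1
        linarith
      have h5 : r⁻¹ • A.symm (w (x₀ + r • y)) - y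
          = r⁻¹ • A.symm (w (x₀ + r • y) - A (r • y)) := by
        rw [map_sub, A.symm_apply_apply, smul_sub, inv_smul_smul₀ hr.ne']
      have h6 := (A.symm : EuclideanSpace ℝ (Fin n) →L[ℝ] EuclideanSpace ℝ (Fin n)).le_opNorm_of_le
        h3
      rw [h5, norm_smul, norm_inv, Real.norm_of_nonneg hr.le, inv_mul_le_iff₀ hr]
      calc _ ≤ _ := h6
        _ = ‖(A.symm : EuclideanSpace ℝ (Fin n) →L[ℝ] EuclideanSpace ℝ (Fin n))‖ * (2 * c) * r := by
          ring
        _ ≤ 1 / 2 * r := mul_le_mul_of_nonneg_right hAc hr.le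
        _ = r * (1 / 2) := mul_comm _ _)
  refine ⟨x₀ + r • y, hmem y hy, ?_⟩
  simpa [hr.ne'] using hy0
end

section
/- Let v : ℝⁿ → ℝⁿ be continuously differentiable on a neighborhood of a closed ball B̄(x₀, r), with v(x₀) = 0, Dv(x₀) invertible, and v(x) ≠ 0 for all x ∈ B̄(x₀, r) \ {x₀}. Then there exists ε > 0 such that every continuously differentiable map w : ℝⁿ → ℝⁿ with sup_{x ∈ B̄(x₀,r)} (‖w(x) − v(x)‖ + ‖Dw(x) − Dv(x)‖) < ε has exactly one zero in B̄(x₀, r), and the derivative of w at that zero is invertible. (The number of nondegenerate zeros is locally constant under C¹-small perturbations.) -/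
open Metric

/-- The number of nondegenerate zeros is locally constant under `C¹`-small perturbations:
if `v` is `C¹` on a neighborhood of `B̄(x₀, r)`, has `x₀` as its unique zero there, and
`Dv(x₀)` is invertible, then every `C¹` field `w` that is `C¹`-close to `v` on `B̄(x₀, r)`
has exactly one zero in `B̄(x₀, r)`, and that zero is nondegenerate. -/
theorem stmt17 {n : ℕ} (v : EuclideanSpace ℝ (Fin n) → EuclideanSpace ℝ (Fin n))
    (x₀ : EuclideanSpace ℝ (Fin n)) (r : ℝ) (hr : 0 < r)
    (U : Set (EuclideanSpace ℝ (Fin n))) (hUopen : IsOpen U)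
    (hUB : closedBall x₀ r ⊆ U) (hv : ContDiffOn ℝ 1 v U)
    (hv0 : v x₀ = 0) (hinv : IsUnit (fderiv ℝ v x₀))
    (hiso : ∀ x ∈ closedBall x₀ r, x ≠ x₀ → v x ≠ 0) :
    ∃ ε > (0 : ℝ),
      ∀ w : EuclideanSpace ℝ (Fin n) → EuclideanSpace ℝ (Fin n), ContDiff ℝ 1 w →
        (∀ x ∈ closedBall x₀ r, ‖w x - v x‖ + ‖fderiv ℝ w x - fderiv ℝ v x‖ < ε) →
        ∃ x, (x ∈ closedBall x₀ r ∧ w x = 0 ∧ IsUnit (fderiv ℝ w x)) ∧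
          ∀ y ∈ closedBall x₀ r, w y = 0 → y = x := by
  rcases subsingleton_or_nontrivial (EuclideanSpace ℝ (Fin n)) with hsub | hnt
  · refine ⟨1, one_pos, fun w _ _ ↦ ⟨x₀, ⟨mem_closedBall_self hr.le, Subsingleton.elim _ _, ?_⟩,
      fun y _ _ ↦ Subsingleton.elim _ _⟩⟩
    rwa [Subsingleton.elim (fderiv ℝ w x₀) (fderiv ℝ v x₀)]
  have hx₀U : x₀ ∈ U := hUB (mem_closedBall_self hr.le)
  obtain ⟨A, hA⟩ : ∃ A : EuclideanSpace ℝ (Fin n) ≃L[ℝ] EuclideanSpace ℝ (Fin n),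
      (A : EuclideanSpace ℝ (Fin n) →L[ℝ] EuclideanSpace ℝ (Fin n)) = fderiv ℝ v x₀ :=
    ⟨ContinuousLinearEquiv.unitsEquiv ℝ _ hinv.unit, rfl⟩
  have hN : 0 < ‖(A.symm : EuclideanSpace ℝ (Fin n) →L[ℝ] EuclideanSpace ℝ (Fin n))‖₊⁻¹ :=
    inv_pos.2 A.nnnorm_symm_pos
  set M := ‖(A.symm : EuclideanSpace ℝ (Fin n) →L[ℝ] EuclideanSpace ℝ (Fin n))‖₊⁻¹
  obtain ⟨η, hη, hηunit⟩ := Metric.isOpen_iff.1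
    (Units.isOpen (R := EuclideanSpace ℝ (Fin n) →L[ℝ] EuclideanSpace ℝ (Fin n))) _ hinv
  obtain ⟨c, hc, hcM, hcη⟩ : ∃ c : NNReal, 0 < c ∧ 4 * (c : ℝ) ≤ M ∧ 4 * (c : ℝ) ≤ η := by
    refine ⟨min (M / 4) (Real.toNNReal (η / 4)), by positivity, ?_, ?_⟩
    · have := min_le_left ((M : ℝ) / 4) (Real.toNNReal (η / 4))
      push_cast
      linarith
    · have := min_le_right ((M : ℝ) / 4) (Real.toNNReal (η / 4))
      rw [Real.coe_toNNReal _ (by positivity)] at this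
      push_cast
      rw [Real.coe_toNNReal _ (by positivity)]
      linarith
  have hcont : ContinuousAt (fderiv ℝ v) x₀ :=
    (hv.continuousOn_fderiv_of_isOpen hUopen le_rfl).continuousAt (hUopen.mem_nhds hx₀U)
  obtain ⟨δ₀, hδ₀, hδ₀c⟩ := Metric.continuousAt_iff.1 hcont c hc
  obtain ⟨δ, hδ, hδr, hδδ₀⟩ : ∃ δ > 0, δ ≤ r ∧ δ < δ₀ :=
    ⟨min r (δ₀ / 2), by positivity, min_le_left _ _, (min_le_right _ _).trans_lt (by linarith)⟩
  have hδB : closedBall x₀ δ ⊆ closedBall x₀ r := closedBall_subset_closedBall hδr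
  obtain ⟨m, hm, hmv⟩ : ∃ m, 0 < m ∧ ∀ x ∈ closedBall x₀ r \ ball x₀ δ, m ≤ ‖v x‖ := by
    refine ((isCompact_closedBall x₀ r).diff isOpen_ball).exists_forall_le'
      ((hv.continuousOn.mono (Set.sdiff_subset.trans hUB)).norm) fun x hx ↦ ?_
    refine norm_pos_iff.2 (hiso x hx.1 ?_)
    rintro rfl
    exact hx.2 (mem_ball_self hδ)
  refine ⟨min (min (c : ℝ) m) ((M - 2 * c) * δ), lt_min (lt_min hc hm) (mul_pos ?_ hδ), ?_⟩
  · have : (0 : ℝ) < c := hc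
    linarith
  intro w hw hwv
  have hwv₀ : ∀ x ∈ closedBall x₀ r, ‖w x - v x‖ < min (min (c : ℝ) m) ((M - 2 * c) * δ) := fun x hx ↦
    (le_add_of_nonneg_right (norm_nonneg _)).trans_lt (hwv x hx)
  have hwv₁ : ∀ x ∈ closedBall x₀ r, ‖fderiv ℝ w x - fderiv ℝ v x‖ < c := fun x hx ↦
    ((le_add_of_nonneg_left (norm_nonneg _)).trans_lt (hwv x hx)).trans_le
      ((min_le_left _ _).trans (min_le_left _ _))
  have hwA : ∀ x ∈ closedBall x₀ δ, ‖fderiv ℝ w x - fderiv ℝ v x₀‖ ≤ 2 * c := fun x hx ↦ by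
    have h₁ := hδ₀c ((mem_closedBall.1 hx).trans_lt hδδ₀)
    rw [dist_eq_norm] at h₁
    have h₂ := hwv₁ x (hδB hx)
    have h₃ := norm_sub_le_norm_sub_add_norm_sub (fderiv ℝ w x) (fderiv ℝ v x) (fderiv ℝ v x₀)
    linarith
  have happ : ApproximatesLinearOn w
      (A : EuclideanSpace ℝ (Fin n) →L[ℝ] EuclideanSpace ℝ (Fin n)) (closedBall x₀ δ) (2 * c) := by
    intro x hx y hy
    have := (convex_closedBall x₀ δ).norm_image_sub_le_of_norm_fderiv_le'
      (fun z _ ↦ (hw.differentiable one_ne_zero) z) hwA hy hx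
    rw [hA]
    simpa using this
  have hcM' : 2 * c < M := by
    have : (0 : ℝ) < c := hc
    rw [← NNReal.coe_lt_coe]
    push_cast
    linarith
  obtain ⟨x, hx, hwx⟩ : ∃ x ∈ closedBall x₀ δ, w x = 0 := by
    refine happ.surjOn_closedBall_of_nonlinearRightInverse A.toNonlinearRightInverse hδ.le
      subset_rfl ?_
    have := (hwv₀ x₀ (mem_closedBall_self hr.le)).trans_le (min_le_right _ _)
    rw [hv0, sub_zero] at this
    rw [mem_closedBall, dist_zero_left]
    exact this.le
  refine ⟨x, ⟨hδB hx, hwx, hηunit ?_⟩, fun y hy hwy ↦ ?_⟩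
  · rw [mem_ball, dist_eq_norm]
    have : (0 : ℝ) < c := hc
    linarith [hwA x hx]
  · have hyδ : y ∈ closedBall x₀ δ := by
      by_contra h
      have h₁ := hmv y ⟨hy, fun h' ↦ h (ball_subset_closedBall h')⟩
      have h₂ := (hwv₀ y hy).trans_le ((min_le_left _ _).trans (min_le_right _ _))
      rw [hwy, zero_sub, norm_neg] at h₂
      linarith
    exact happ.injOn (Or.inr hcM') hyδ hx (hwy.trans hwx.symm)
end
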